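/- (Kozak–Simonenko.) Let a : ℤ² → ℂ be finitely supported and let T be the Laurent (Toeplitz) operator on ℓ¹(ℤ²) given by (Tx)(j) = Σ_{k∈ℤ²} a_{j−k} x_k. Assume the symbol s(θ) = Σ_{k∈ℤ²} a_k e^{i⟨k,θ⟩} satisfies s(θ) ≠ 0 for all θ ∈ 𝕋², and that its topological index is zero, i.e. there is a continuous function h : ℝ² → ℂ, 2π-periodic in each coordinate, with s = exp ∘ h. Then there exist positive numbers r, R, c and a sequence of convex lattice polygons Π_n ∈ 𝔐(r, R), n ∈ ℕ, tending to ℝ² (every bounded set is eventually contained in Π_n), such that for every n the compression P_n T P_n, regarded as an operator on ℓ¹(Π_n ∩ ℤ²), is boundedly invertible and ‖(P_n T P_n)⁻¹‖ ≤ c. -/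

import Mathlib

/-!
Statement 15 (Kozak–Simonenko finite section theorem):
Let `a : ℤ² → ℂ` be finitely supported, `T` the Laurent operator `(Tx)(j) = Σ_k a_{j-k} x_k`
on `ℓ¹(ℤ²)`. If the symbol `s(θ) = Σ_k a_k e^{i⟨k,θ⟩}` never vanishes and has topological
index zero (i.e. `s = exp ∘ h` for some continuous `2π`-periodic `h`), then there are
`r, R, c > 0` and polygons `Π_n ∈ 𝔐(r,R)` tending to `ℝ²` such that each compression
`P_n T P_n`, as an operator on `ℓ¹(Π_n ∩ ℤ²)` (a finite set), is boundedly invertible with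
`‖(P_n T P_n)⁻¹‖ ≤ c`; this is expressed below as unique solvability in the coordinates
indexed by `Π_n ∩ ℤ²` together with the ℓ¹ bound `‖x‖₁ ≤ c ‖y‖₁` on the solution.
-/

noncomputable section

/-- The embedding of the lattice `ℤ²` into the Euclidean plane. -/
def latticeCoe (k : Fin 2 → ℤ) : EuclideanSpace ℝ (Fin 2) :=
  (WithLp.equiv 2 (Fin 2 → ℝ)).symm fun i => (k i : ℝ)

/-- `M ⊆ ℤ²` is a canonical discrete half-space if both `M` and its complement are closed
under addition. -/
def IsCanonicalDiscreteHalfSpace (M : Set (Fin 2 → ℤ)) : Prop :=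
  (∀ x ∈ M, ∀ y ∈ M, x + y ∈ M) ∧ (∀ x ∉ M, ∀ y ∉ M, x + y ∉ M)

/-- `M ⊆ ℤ²` is a discrete half-space if some translate `M + j` is a canonical discrete
half-space. -/
def IsDiscreteHalfSpace (M : Set (Fin 2 → ℤ)) : Prop :=
  ∃ j : Fin 2 → ℤ, IsCanonicalDiscreteHalfSpace ((fun x => x + j) '' M)

/-- A convex lattice polygon: the convex hull of a finite set of lattice points. -/
def IsConvexLatticePolygon (P : Set (EuclideanSpace ℝ (Fin 2))) : Prop :=
  ∃ F : Finset (Fin 2 → ℤ), P = convexHull ℝ (latticeCoe '' ↑F)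

/-- Membership in the Kozak–Simonenko class `𝔐(r,R)`. -/
def MemKS (r R : ℝ) (P : Set (EuclideanSpace ℝ (Fin 2))) : Prop :=
  IsConvexLatticePolygon P ∧
  (∀ x : EuclideanSpace ℝ (Fin 2), ∃ M : Set (Fin 2 → ℤ), IsDiscreteHalfSpace M ∧
    {k : Fin 2 → ℤ | latticeCoe k ∈ P ∧ latticeCoe k ∈ Metric.ball x r}
      = {k : Fin 2 → ℤ | k ∈ M ∧ latticeCoe k ∈ Metric.ball x r}) ∧
  Metric.ball (0 : EuclideanSpace ℝ (Fin 2)) R ⊆ P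

/-- The symbol of the convolution kernel `a : ℤ² → ℂ`. -/
def ksSymbol (a : (Fin 2 → ℤ) → ℂ) (θ : Fin 2 → ℝ) : ℂ :=
  ∑ᶠ k : Fin 2 → ℤ, a k * Complex.exp (Complex.I * (∑ i, (k i : ℝ) * θ i : ℝ))

theorem ks_exp_path {A : Type*} [NormedCommRing A] [NormedAlgebra ℂ A] [CompleteSpace A]
    (p : A) (hp : ∀ t : unitInterval, IsUnit (1 - ((t:ℝ):ℂ) • p)) :
    ∃ L : A, NormedSpace.exp L = 1 - p := by
  let _ : NormedAlgebra ℚ A := NormedAlgebra.restrictScalars ℚ ℂ A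
  let H : Subgroup Aˣ :=
    { carrier := {x | ∃ L : A, NormedSpace.exp L = (x : A)}
      mul_mem' := by
        rintro x y ⟨L, hL⟩ ⟨L', hL'⟩
        exact ⟨L + L', by rw [NormedSpace.exp_add, hL, hL']; simp⟩
      one_mem' := ⟨0, by simp⟩
      inv_mem' := by
        rintro x ⟨L, hL⟩
        refine ⟨-L, ?_⟩
        have h : NormedSpace.exp (-L) * (x : A) = 1 := by
          rw [← hL, ← NormedSpace.exp_add]; simp
        rw [← mul_one (NormedSpace.exp (-L)), ← x.mul_inv, ← mul_assoc, h, one_mul] }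
  have hopen : IsOpen (H : Set Aˣ) := by
    apply Subgroup.isOpen_of_mem_nhds (g := 1)
    have h0 := (hasStrictFDerivAt_exp_zero (𝕂 := ℂ) (𝔸 := A)).map_nhds_eq_of_surj (by
      simp [LinearMap.range_eq_top]
      exact Function.surjective_id)
    have h1 : Set.range (NormedSpace.exp : A → A) ∈ nhds ((1 : Aˣ) : A) := by
      have : ((1 : Aˣ) : A) = NormedSpace.exp (0:A) := by simp
      rw [this, ← h0]
      exact Filter.range_mem_map
    exact Units.continuous_val.continuousAt.preimage_mem_nhds h1
  have hclopen : IsClopen (H : Set Aˣ) := ⟨Subgroup.isClosed_of_isOpen _ hopen, hopen⟩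
  let f : unitInterval → Aˣ := fun t => (hp t).unit
  have hf : Continuous f := by
    rw [Units.isOpenEmbedding_val.continuous_iff]
    have : (Units.val ∘ f) = fun t : unitInterval => 1 - ((t:ℝ):ℂ) • p := by
      ext t; simp [f]
    rw [this]; fun_prop
  have hpc : IsPreconnected (Set.range f) := isPreconnected_range hf
  have := hpc.subset_isClopen hclopen ⟨f 0, ⟨0, rfl⟩, by
    have : f 0 = 1 := by ext; simp [f]
    rw [this]; exact H.one_mem⟩ ⟨1, rfl⟩
  obtain ⟨L, hL⟩ := this
  exact ⟨L, by rw [hL]; simp [f]⟩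

abbrev KE := lp (fun _ : Fin 2 → ℤ => ℂ) 1

theorem KE.sum_le (x : KE) (s : Finset (Fin 2 → ℤ)) : ∑ j ∈ s, ‖x j‖ ≤ ‖x‖ := by
  simpa using lp.sum_rpow_le_norm_rpow (p := 1) (by simp) x s

theorem KE.norm_le (x : KE) {C : ℝ} (h0 : 0 ≤ C) (h : ∀ s : Finset (Fin 2 → ℤ), ∑ j ∈ s, ‖x j‖ ≤ C) :
    ‖x‖ ≤ C :=
  lp.norm_le_of_forall_sum_le (p := 1) (by simp) h0 (by simpa using h)

def ksMk (f : KE → (Fin 2 → ℤ) → ℂ) (hadd : ∀ x y, f (x + y) = f x + f y)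
    (hsmul : ∀ (c : ℂ) x, f (c • x) = c • f x)
    (hb : ∀ x (s : Finset (Fin 2 → ℤ)), ∑ j ∈ s, ‖f x j‖ ≤ ‖x‖) : KE →L[ℂ] KE :=
  LinearMap.mkContinuous
    { toFun := fun x => ⟨f x, memℓp_gen' (C := ‖x‖) (by simpa using hb x)⟩
      map_add' := fun x y => by ext j; simp [hadd]; rfl
      map_smul' := fun c x => by ext j; simp [hsmul] } 1
    (fun x => by
      rw [one_mul]
      exact KE.norm_le _ (norm_nonneg _) (by simpa using hb x))

theorem ksMk_apply (f hadd hsmul hb) (x : KE) (j) : (ksMk f hadd hsmul hb x) j = f x j := rfl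

theorem ksMk_norm (f hadd hsmul hb) : ‖ksMk f hadd hsmul hb‖ ≤ 1 :=
  LinearMap.mkContinuous_norm_le _ zero_le_one _

def ksShift (k : Fin 2 → ℤ) : KE →L[ℂ] KE :=
  ksMk (fun x j => x (j - k)) (fun x y => by ext; simp) (fun c x => by ext; simp) (fun x s => by
    have := KE.sum_le x (s.map (Equiv.subRight k).toEmbedding)
    simpa using this)

open Classical in
def ksProj (M : Set (Fin 2 → ℤ)) : KE →L[ℂ] KE :=
  ksMk (fun x j => if j ∈ M then x j else 0)
    (fun x y => by ext j; by_cases h : j ∈ M <;> simp [h])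
    (fun c x => by ext j; by_cases h : j ∈ M <;> simp [h]) (fun x s => by
    refine le_trans (Finset.sum_le_sum fun j _ => ?_) (KE.sum_le x s)
    by_cases h : j ∈ M <;> simp [h])

theorem ksShift_apply (k) (x : KE) (j) : ksShift k x j = x (j - k) := rfl

open Classical in
theorem ksProj_apply (M) (x : KE) (j) : ksProj M x j = if j ∈ M then x j else 0 := rfl

theorem ksShift_norm (k) : ‖ksShift k‖ ≤ 1 := ksMk_norm _ _ _ _
theorem ksProj_norm (M) : ‖ksProj M‖ ≤ 1 := ksMk_norm _ _ _ _

def ksShiftHom : Multiplicative (Fin 2 → ℤ) →* (KE →L[ℂ] KE) where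
  toFun k := ksShift k.toAdd
  map_one' := by ext x j; simp [ksShift_apply]
  map_mul' k l := by
    ext x j
    simp only [mul_apply_eq_comp, ksShift_apply, toAdd_mul]
    abel_nf

def ksPhi : AddMonoidAlgebra ℂ (Fin 2 → ℤ) →ₐ[ℂ] (KE →L[ℂ] KE) :=
  AddMonoidAlgebra.lift ℂ _ _ ksShiftHom

theorem ksPhi_single (k : Fin 2 → ℤ) (c : ℂ) :
    ksPhi (AddMonoidAlgebra.single k c) = c • ksShift k := by
  simp [ksPhi, AddMonoidAlgebra.lift_single]; rfl

def ksElt (s : Finset (Fin 2 → ℤ)) (c : (Fin 2 → ℤ) → ℂ) : KE →L[ℂ] KE := ∑ k ∈ s, c k • ksShift k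

theorem ksPhi_range (x : KE →L[ℂ] KE) (hx : x ∈ ksPhi.range) : ∃ s c, x = ksElt s c := by
  obtain ⟨f, rfl⟩ := hx
  refine ⟨f.coeff.support, f.coeff, ?_⟩
  change ksPhi f = _
  rw [ksPhi, AddMonoidAlgebra.lift_apply]
  rfl

theorem ksElt_mem (s c) : ksElt s c ∈ ksPhi.range := by
  refine Subalgebra.sum_mem _ fun k _ => ⟨AddMonoidAlgebra.single k (c k), ksPhi_single _ _⟩

theorem ksElt_apply (s c) (x : KE) (j) : ksElt s c x j = ∑ k ∈ s, c k * x (j - k) := by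
  simp only [ksElt, sum_apply, lp.coeFn_sum]
  refine (Finset.sum_apply j s _).trans (Finset.sum_congr rfl fun k _ => ?_)
  rfl

theorem ksElt_norm_le (s c) : ‖ksElt s c‖ ≤ ∑ k ∈ s, ‖c k‖ := by
  refine (norm_sum_le _ _).trans (Finset.sum_le_sum fun k _ => ?_)
  rw [norm_smul]
  exact mul_le_of_le_one_right (norm_nonneg _) (ksShift_norm k)

def ksE (k : Fin 2 → ℤ) : KE := lp.single 1 k 1

theorem ksE_norm (k) : ‖ksE k‖ = 1 := by simp [ksE, lp.norm_single]

theorem ksE_apply (k j) : ksE k j = if j = k then 1 else 0 := by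
  simp [ksE, lp.single_apply, Pi.single_apply]

theorem ksElt_le_norm (s c) : ∑ k ∈ s, ‖c k‖ ≤ ‖ksElt s c‖ := by
  have h1 := (ksElt s c).le_opNorm (ksE 0)
  rw [ksE_norm, mul_one] at h1
  refine le_trans ?_ h1
  refine le_trans (le_of_eq ?_) (KE.sum_le _ s)
  refine Finset.sum_congr rfl fun j hj => ?_
  rw [ksElt_apply]
  simp only [ksE_apply, sub_eq_zero]
  simp [hj]

theorem ks_trig_approx (h : (Fin 2 → ℝ) → ℂ) (hc : Continuous h)
    (hper : ∀ (θ : Fin 2 → ℝ) (i : Fin 2), h (Function.update θ i (θ i + 2 * Real.pi)) = h θ)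
    {ε : ℝ} (hε : 0 < ε) :
    ∃ (s : Finset (Fin 2 → ℤ)) (c : (Fin 2 → ℤ) → ℂ), ∀ θ : Fin 2 → ℝ,
      ‖h θ - ∑ k ∈ s, c k * Complex.exp (Complex.I * (∑ i, (k i : ℝ) * θ i : ℝ))‖ < ε := by
  let q : C(Fin 2 → ℝ, UnitAddTorus (Fin 2)) := ⟨fun x i => (x i : UnitAddCircle), by
    refine continuous_pi fun i => (AddCircle.continuous_mk' _).comp (continuous_apply i)⟩
  have hq : Topology.IsQuotientMap q :=
    (IsOpenQuotientMap.piMap (fun i => QuotientAddGroup.isOpenQuotientMap_mk)).isQuotientMap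
  let h1 : C(Fin 2 → ℝ, ℂ) := ⟨fun x => h (fun i => 2 * Real.pi * x i), by fun_prop⟩
  have hp : ∀ i, Function.Periodic h (Pi.single i (2 * Real.pi)) := by
    intro i θ
    rw [← hper θ i]
    congr 1
    ext j
    by_cases hj : j = i
    · subst hj; simp
    · simp [hj]
  have hfac : Function.FactorsThrough h1 q := by
    intro x y hxy
    have hx : ∀ i, ∃ n : ℤ, y i = x i + n := by
      intro i
      have := congrFun hxy i
      change (x i : UnitAddCircle) = (y i : UnitAddCircle) at this
      have h2 : ((y i - x i : ℝ) : UnitAddCircle) = 0 := by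
        rw [AddCircle.coe_sub, this, sub_self]
      obtain ⟨n, hn⟩ := (AddCircle.coe_eq_zero_iff _).1 h2
      refine ⟨n, ?_⟩
      simp at hn
      linarith
    obtain ⟨n0, h0⟩ := hx 0
    obtain ⟨n1, hh1⟩ := hx 1
    change h _ = h _
    rw [← (hp 0).zsmul n0, ← (hp 1).zsmul n1]
    congr 1
    ext i
    fin_cases i
    · simp [h0]; ring
    · simp [hh1]; ring
  let F := hq.lift h1 hfac
  have hF : ∀ x, F (q x) = h1 x := fun x => by
    have := hq.lift_comp h1 hfac
    exact DFunLike.congr_fun this x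
  have hmem : F ∈ (Submodule.span ℂ (Set.range (UnitAddTorus.mFourier (d := Fin 2)))).topologicalClosure := by
    rw [UnitAddTorus.span_mFourier_closure_eq_top]; trivial
  obtain ⟨G, hG, hd⟩ := Metric.mem_closure_iff.1 hmem ε hε
  obtain ⟨c, rfl⟩ := Finsupp.mem_span_range_iff_exists_finsupp.1 hG
  refine ⟨c.support, c, fun θ => ?_⟩
  have h3 := (ContinuousMap.dist_apply_le_dist (q (fun i => θ i / (2 * Real.pi)))).trans_lt hd
  rw [hF, dist_eq_norm] at h3
  have hpi : Real.pi ≠ 0 := Real.pi_ne_zero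
  have hpi' : (Real.pi : ℂ) ≠ 0 := by exact_mod_cast hpi
  refine lt_of_eq_of_lt (congrArg norm (congrArg₂ (fun x y : ℂ => x - y) ?_ ?_)) h3
  · change _ = h _
    congr 1
    ext i
    field_simp
  · rw [Finsupp.sum, ContinuousMap.sum_apply]
    refine Finset.sum_congr rfl fun k _ => ?_
    simp only [ContinuousMap.smul_apply, smul_eq_mul]
    congr 1
    change _ = ∏ i, (fourier (k i)) ((θ i / (2 * Real.pi) : ℝ) : UnitAddCircle)
    rw [Fin.prod_univ_two, fourier_coe_apply, fourier_coe_apply, ← Complex.exp_add]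
    congr 1
    rw [Fin.sum_univ_two]
    push_cast
    field_simp

theorem ks_log_abs {A : Type*} [NormedCommRing A] [NormedAlgebra ℂ A] [CompleteSpace A]
    (x g : A) (hx : ∀ χ : A →ₐ[ℂ] ℂ, ‖χ x * Complex.exp (-χ g) - 1‖ < 1) :
    ∃ L : A, NormedSpace.exp L = x := by
  let _ : NormedAlgebra ℚ A := NormedAlgebra.restrictScalars ℚ ℂ A
  obtain ⟨L, hL⟩ := ks_exp_path (1 - x * NormedSpace.exp (-g)) (by
    intro r
    by_contra hu
    obtain ⟨χ', hχ⟩ := WeakDual.CharacterSpace.exists_apply_eq_zero hu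
    let χ : A →ₐ[ℂ] ℂ := WeakDual.CharacterSpace.equivAlgHom χ'
    replace hχ : χ (1 - ((r:ℝ):ℂ) • (1 - x * NormedSpace.exp (-g))) = 0 := hχ
    have hcont : Continuous χ := map_continuous χ'
    have h1 : χ (NormedSpace.exp (-g)) = Complex.exp (- χ g) := by
      rw [NormedSpace.map_exp χ hcont, map_neg, Complex.exp_eq_exp_ℂ]
    rw [map_sub, map_smul, map_sub, map_mul, h1, map_one] at hχ
    have h3 := hx χ
    set w := χ x * Complex.exp (-χ g) - 1 with hw
    have h4 : ((r:ℝ):ℂ) * w = -1 := by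
      rw [smul_eq_mul] at hχ
      rw [hw]
      linear_combination hχ
    have h5 := congrArg norm h4
    rw [norm_mul, norm_neg, norm_one, Complex.norm_real, Real.norm_eq_abs, abs_of_nonneg r.2.1] at h5
    have := r.2.2
    nlinarith [norm_nonneg w, r.2.1])
  refine ⟨L + g, ?_⟩
  rw [NormedSpace.exp_add, hL, sub_sub_cancel, mul_assoc, ← NormedSpace.exp_add]
  simp

theorem ks_map_exp {A B : Type*} [NormedCommRing A] [NormedAlgebra ℂ A] [CompleteSpace A]
    [NormedRing B] [NormedAlgebra ℂ B] (f : A →ₐ[ℂ] B) (hf : Continuous f) (x : A) :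
    f (NormedSpace.exp x) = NormedSpace.exp (f x) := by
  let _ : NormedAlgebra ℚ A := NormedAlgebra.restrictScalars ℚ ℂ A
  let _ : NormedAlgebra ℚ B := NormedAlgebra.restrictScalars ℚ ℂ B
  exact NormedSpace.map_exp f hf x

def ksAlg : Subalgebra ℂ (KE →L[ℂ] KE) := ksPhi.range.topologicalClosure

theorem ksAlg_comm (x y : ksAlg) : x * y = y * x := by
  have hs : ∀ x y : ksPhi.range, x * y = y * x := by
    rintro ⟨_, x, rfl⟩ ⟨_, y, rfl⟩
    apply Subtype.ext
    change ksPhi x * ksPhi y = ksPhi y * ksPhi x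
    rw [← map_mul, mul_comm, map_mul]
  exact (Subalgebra.commRingTopologicalClosure ksPhi.range hs).mul_comm x y

instance : NormedCommRing ksAlg :=
  { (inferInstance : NormedRing ksAlg) with mul_comm := ksAlg_comm }

instance : CompleteSpace ksAlg :=
  (Subalgebra.isClosed_topologicalClosure ksPhi.range).completeSpace_coe

def ksA (s : Finset (Fin 2 → ℤ)) (c : (Fin 2 → ℤ) → ℂ) : ksAlg := ⟨ksElt s c, ksPhi.range.le_topologicalClosure (ksElt_mem s c)⟩

def ksS (k : Fin 2 → ℤ) : ksAlg := ⟨ksShift k, ksPhi.range.le_topologicalClosure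
  ⟨AddMonoidAlgebra.single k 1, by simpa using ksPhi_single k 1⟩⟩

theorem ksA_eq (s c) : ksA s c = ∑ k ∈ s, c k • ksS k := by
  apply Subtype.ext
  simp [ksA, ksElt, ksS]

theorem ks_char (χ : ksAlg →ₐ[ℂ] ℂ) : ∃ θ : Fin 2 → ℝ, ∀ s c, χ (ksA s c) =
    ∑ k ∈ s, c k * Complex.exp (Complex.I * (∑ i, (k i : ℝ) * θ i : ℝ)) := by
  let ψ : AddChar (Fin 2 → ℤ) ℂ :=
    { toFun := fun k => χ (ksS k)
      map_zero_eq_one' := by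
        rw [← map_one χ]; congr 1
        apply Subtype.ext
        exact map_one ksShiftHom
      map_add_eq_mul' := fun k l => by
        rw [← map_mul]; congr 1
        apply Subtype.ext
        exact map_mul ksShiftHom (Multiplicative.ofAdd k) (Multiplicative.ofAdd l) }
  have hle : ∀ k, ‖ψ k‖ ≤ 1 := by
    intro k
    have h1 := AlgHom.norm_apply_le_self_mul_norm_one χ (ksS k)
    have h2 : ‖ksS k‖ ≤ 1 := ksShift_norm k
    have h3 : ‖(1 : ksAlg)‖ ≤ 1 := ContinuousLinearMap.norm_id_le
    refine h1.trans ?_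
    nlinarith [norm_nonneg (ksS k), norm_nonneg (1:ksAlg)]
  have hone : ∀ k, ‖ψ k‖ = 1 := by
    intro k
    have h1 : ‖ψ k‖ * ‖ψ (-k)‖ = 1 := by
      rw [← norm_mul, ← AddChar.map_add_eq_mul]; simp
    have := hle k; have := hle (-k)
    nlinarith [norm_nonneg (ψ k), norm_nonneg (ψ (-k))]
  let θ : Fin 2 → ℝ := fun i => Complex.arg (ψ (Pi.single i 1))
  have hθ : ∀ i, ψ (Pi.single i 1) = Complex.exp (θ i * Complex.I) := by
    intro i
    have := Complex.norm_mul_exp_arg_mul_I (ψ (Pi.single i 1))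
    rw [hone] at this
    simpa using this.symm
  refine ⟨θ, fun s c => ?_⟩
  rw [ksA_eq, map_sum]
  refine Finset.sum_congr rfl fun k _ => ?_
  rw [map_smul, smul_eq_mul]
  congr 1
  change ψ k = _
  have hk : k = k 0 • Pi.single 0 1 + k 1 • Pi.single 1 1 := by
    ext i; fin_cases i <;> simp
  conv_lhs => rw [hk]
  rw [AddChar.map_add_eq_mul, AddChar.map_zsmul_eq_zpow, AddChar.map_zsmul_eq_zpow, hθ, hθ,
    ← Complex.exp_int_mul, ← Complex.exp_int_mul, ← Complex.exp_add]
  congr 1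
  rw [Fin.sum_univ_two]
  push_cast
  ring

theorem ks_log (s : Finset (Fin 2 → ℤ)) (a : (Fin 2 → ℤ) → ℂ) 
    (h : (Fin 2 → ℝ) → ℂ) (hc : Continuous h)
    (hper : ∀ (θ : Fin 2 → ℝ) (i : Fin 2), h (Function.update θ i (θ i + 2 * Real.pi)) = h θ)
    (hexp : ∀ θ : Fin 2 → ℝ, ∑ k ∈ s, a k * Complex.exp (Complex.I * (∑ i, (k i : ℝ) * θ i : ℝ))
      = Complex.exp (h θ)) :
    ∃ H : KE →L[ℂ] KE, H ∈ closure {x | ∃ s c, x = ksElt s c} ∧ NormedSpace.exp H = ksElt s a := by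
  obtain ⟨t, c, htc⟩ := ks_trig_approx h hc hper (ε := 1/4) (by norm_num)
  obtain ⟨L, hL⟩ := ks_log_abs (ksA s a) (ksA t c) (by
    intro χ
    obtain ⟨θ, hθ⟩ := ks_char χ
    rw [hθ, hθ, hexp, ← Complex.exp_add, ← sub_eq_add_neg]
    have h2 := htc θ
    have h3 := Complex.norm_exp_sub_one_le (x := h θ -
      ∑ k ∈ t, c k * Complex.exp (Complex.I * (∑ i, (k i : ℝ) * θ i : ℝ))) (by linarith)
    linarith)
  refine ⟨(L : KE →L[ℂ] KE), ?_, ?_⟩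
  · have : (L : KE →L[ℂ] KE) ∈ closure (ksPhi.range : Set (KE →L[ℂ] KE)) := L.2
    exact closure_mono (fun x hx => ksPhi_range x hx) this
  · have h2 := ks_map_exp ksAlg.val continuous_subtype_val L
    rw [hL] at h2
    exact h2.symm

instance : Nontrivial KE := ⟨ksE 0, 0, fun h => by
  have := ksE_norm 0
  rw [h] at this; simp at this⟩

theorem ks_exp_norm {c : ℝ} (X : KE →L[ℂ] KE) (hX : ‖X‖ ≤ c) :
    ‖NormedSpace.exp X‖ ≤ Real.exp c := by
  have h1 := NormedSpace.exp_series_hasSum_exp' (𝕂 := ℂ) X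
  have h2 := NormedSpace.exp_series_hasSum_exp' (𝕂 := ℝ) c
  rw [← Real.exp_eq_exp_ℝ] at h2
  rw [← h1.tsum_eq]
  refine tsum_of_norm_bounded h2 fun n => ?_
  rw [norm_smul, smul_eq_mul]
  have : ‖((n.factorial : ℂ))⁻¹‖ = ((n.factorial : ℝ))⁻¹ := by simp
  rw [this]
  gcongr
  exact (norm_pow_le X n).trans (by gcongr)

theorem ks_exp_taylor (c : ℝ) {δ : ℝ} (hδ : 0 < δ) : ∃ N : ℕ, ∀ X : KE →L[ℂ] KE, ‖X‖ ≤ c →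
    ‖NormedSpace.exp X - ∑ n ∈ Finset.range N, ((n.factorial : ℂ))⁻¹ • X ^ n‖ ≤ δ := by
  have h1 := (NormedSpace.exp_hasFPowerSeriesOnBall (𝕂 := ℂ) (𝔸 := KE →L[ℂ] KE)).tendstoUniformlyOn
    (r' := Real.toNNReal (|c| + 1)) ENNReal.coe_lt_top
  rw [Metric.tendstoUniformlyOn_iff] at h1
  obtain ⟨N, hN⟩ := (h1 δ hδ).exists
  refine ⟨N, fun X hX => ?_⟩
  have h2 := hN X (by
    rw [Metric.mem_ball, dist_zero_right, Real.coe_toNNReal _ (by positivity)]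
    linarith [le_abs_self c])
  rw [dist_eq_norm, zero_add, FormalMultilinearSeries.partialSum] at h2
  simp only [NormedSpace.expSeries_apply_eq] at h2
  exact h2.le

def ksMaps (U V : Set (Fin 2 → ℤ)) (A : KE →L[ℂ] KE) : Prop :=
  ∀ x : KE, (∀ j ∉ U, x j = 0) → ∀ j ∉ V, A x j = 0

theorem ksMaps.mul {U V W} {A B} (hA : ksMaps V W A) (hB : ksMaps U V B) : ksMaps U W (A * B) :=
  fun x hx => hA _ (hB x hx)

theorem ksMaps.mono {U V V'} {A} (hA : ksMaps U V A) (h : V ⊆ V') : ksMaps U V' A :=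
  fun x hx j hj => hA x hx j (fun hh => hj (h hh))

theorem ksMaps.add {U V} {A B} (hA : ksMaps U V A) (hB : ksMaps U V B) : ksMaps U V (A + B) := by
  intro x hx j hj
  have h1 := hA x hx j hj
  have h2 := hB x hx j hj
  rw [ContinuousLinearMap.add_apply, lp.coeFn_add, Pi.add_apply, h1, h2, add_zero]

theorem ksMaps.smul {U V} {A} (c : ℂ) (hA : ksMaps U V A) : ksMaps U V (c • A) := by
  intro x hx j hj
  have h1 := hA x hx j hj
  rw [ContinuousLinearMap.smul_apply, lp.coeFn_smul, Pi.smul_apply, h1, smul_zero]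

theorem ksMaps.zero {U V} : ksMaps U V 0 := by
  intro x hx j hj
  simp

theorem ksMaps.one {U} : ksMaps U U 1 := fun x hx => hx

theorem ksMaps.sum {ι : Type*} {U V} (s : Finset ι) (A : ι → KE →L[ℂ] KE)
    (h : ∀ i ∈ s, ksMaps U V (A i)) : ksMaps U V (∑ i ∈ s, A i) :=
  Finset.sum_induction A (ksMaps U V) (fun _ _ => ksMaps.add) ksMaps.zero h

theorem ksMaps_isClosed (U V) : IsClosed {A | ksMaps U V A} := by
  simp only [ksMaps, Set.setOf_forall]
  refine isClosed_iInter fun x => isClosed_iInter fun _ => isClosed_iInter fun j =>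
    isClosed_iInter fun _ => ?_
  have : Continuous fun A : KE →L[ℂ] KE => lp.evalCLM ℂ (fun _ : Fin 2 → ℤ => ℂ) 1 j (A x) := by
    fun_prop
  exact isClosed_eq this continuous_const

def ksPres (U : Set (Fin 2 → ℤ)) : Subalgebra ℂ (KE →L[ℂ] KE) where
  carrier := {A | ksMaps U U A}
  mul_mem' := ksMaps.mul
  add_mem' := ksMaps.add
  algebraMap_mem' c := by
    rw [Algebra.algebraMap_eq_smul_one]
    exact ksMaps.one.smul c

theorem ksMaps.exp {U A} (h : ksMaps U U A) : ksMaps U U (NormedSpace.exp A) := by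
  let _ : NormedAlgebra ℚ (KE →L[ℂ] KE) := NormedAlgebra.restrictScalars ℚ ℂ _
  exact NormedSpace.exp_mem (R := ℂ) (s := ksPres U) (ksMaps_isClosed U U) h

theorem ksMaps_shift {U V} {k} (h : ∀ j ∈ U, j + k ∈ V) : ksMaps U V (ksShift k) := by
  intro x hx j hj
  rw [ksShift_apply]
  refine hx _ fun hh => hj ?_
  simpa using h _ hh

theorem ksMaps_elt {U V} {s c} (h : ∀ k ∈ s, ∀ j ∈ U, j + k ∈ V) : ksMaps U V (ksElt s c) :=
  ksMaps.sum _ _ fun k hk => (ksMaps_shift (h k hk)).smul _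

theorem ksMaps_proj (U M) : ksMaps U (U ∩ M) (ksProj M) := by
  intro x hx j hj
  rw [ksProj_apply]
  split_ifs with h
  · exact hx j fun hh => hj ⟨hh, h⟩
  · rfl

def ksBox (k : Fin 2 → ℤ) (t : ℤ) : Set (Fin 2 → ℤ) := {j | ∀ i, |j i - k i| ≤ t}

theorem ksBox_mono (k) {t t'} (h : t ≤ t') : ksBox k t ⊆ ksBox k t' := fun _ hj i => (hj i).trans h

theorem ks_bound (s : Finset (Fin 2 → ℤ)) : ∃ D : ℤ, 0 ≤ D ∧ ∀ k ∈ s, ∀ i, |k i| ≤ D := by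
  refine ⟨∑ k ∈ s, ∑ i, |k i|, by positivity, fun k hk i => ?_⟩
  exact (Finset.single_le_sum (f := fun i => |k i|) (fun i _ => abs_nonneg _) (Finset.mem_univ i)).trans
    (Finset.single_le_sum (f := fun k : Fin 2 → ℤ => ∑ i, |k i|)
      (fun k _ => Finset.sum_nonneg fun i _ => abs_nonneg _) hk)

theorem ksMaps_elt_box {s c} {D : ℤ} (hD : ∀ k ∈ s, ∀ i, |k i| ≤ D) (k t) :
    ksMaps (ksBox k t) (ksBox k (t + D)) (ksElt s c) := by
  refine ksMaps_elt fun l hl j hj i => ?_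
  have h1 := hj i
  have h2 := hD l hl i
  rw [Pi.add_apply]
  rw [abs_le] at *
  omega

theorem ksMaps_pow_box {A} {D : ℤ} {k} (hA : ∀ t, ksMaps (ksBox k t) (ksBox k (t + D)) A) (t) (n : ℕ) :
    ksMaps (ksBox k t) (ksBox k (t + n * D)) (A ^ n) := by
  induction n with
  | zero => simpa using ksMaps.one
  | succ n ih =>
    rw [pow_succ']
    have := (hA _).mul ih
    convert this using 2
    push_cast; ring

def ksTaylor (N : ℕ) (X : KE →L[ℂ] KE) : KE →L[ℂ] KE :=
  ∑ n ∈ Finset.range N, ((n.factorial : ℂ))⁻¹ • X ^ n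

theorem ksMaps_taylor_box {A} {D : ℤ} (hD0 : 0 ≤ D) {k}
    (hA : ∀ t, ksMaps (ksBox k t) (ksBox k (t + D)) A) (t) (N : ℕ) :
    ksMaps (ksBox k t) (ksBox k (t + N * D)) (ksTaylor N A) := by
  refine ksMaps.sum _ _ fun n hn => ((ksMaps_pow_box hA t n).mono (ksBox_mono _ ?_)).smul _
  have : (n : ℤ) ≤ N := by exact_mod_cast (Finset.mem_range.1 hn).le
  nlinarith

theorem ksMaps.taylor {U A} (h : ksMaps U U A) (N : ℕ) : ksMaps U U (ksTaylor N A) :=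
  (ksPres U).sum_mem fun n _ => (ksPres U).smul_mem ((ksPres U).pow_mem h n) _

theorem ksMaps.neg {U V A} (h : ksMaps U V A) : ksMaps U V (-A) := by
  simpa using h.smul (-1)

theorem ks_err {B : Type*} [NormedRing B] (P T e w w' x x' : B) {K δ : ℝ} (hδ : 0 ≤ δ) (hP : ‖P‖ ≤ 1)
    (hT : ‖T - e‖ ≤ δ) (he : ‖e‖ ≤ K) (hw : ‖w‖ ≤ K) (hw' : ‖w'‖ ≤ K) (hx : ‖x‖ ≤ K)
    (hwx : ‖w - x‖ ≤ δ) (hwx' : ‖w' - x'‖ ≤ δ) :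
    ‖P * (T * w * P * w') - P * (e * x * P * x')‖ ≤ 3 * δ * K ^ 2 := by
  have hK : 0 ≤ K := (norm_nonneg _).trans he
  have key : ∀ (a b c : B) (α β γ : ℝ), ‖a‖ ≤ α → ‖b‖ ≤ β → ‖c‖ ≤ γ → ‖a * b * P * c‖ ≤ α * β * γ := by
    intro a b c α β γ ha hb hc
    have hα := (norm_nonneg _).trans ha
    have hβ := (norm_nonneg _).trans hb
    calc ‖a * b * P * c‖ ≤ ‖a‖ * ‖b‖ * ‖P‖ * ‖c‖ :=
          (norm_mul_le _ _).trans (by gcongr; exact (norm_mul_le _ _).trans (by gcongr; exact norm_mul_le _ _))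
      _ ≤ α * β * 1 * γ := by gcongr
      _ = _ := by ring
  have h1 := key (T - e) w w' _ _ _ hT hw hw'
  have h2 := key e (w - x) w' _ _ _ he hwx hw'
  have h3 := key e x (w' - x') _ _ _ he hx hwx'
  have : P * (T * w * P * w') - P * (e * x * P * x') =
    P * ((T - e) * w * P * w' + e * (w - x) * P * w' + e * x * P * (w' - x')) := by noncomm_ring
  rw [this]
  calc _ ≤ ‖P‖ * ‖(T - e) * w * P * w' + e * (w - x) * P * w' + e * x * P * (w' - x')‖ := norm_mul_le _ _
    _ ≤ 1 * (δ * K * K + K * δ * K + K * K * δ) := by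
      gcongr
      exact (norm_add_le _ _).trans (add_le_add ((norm_add_le _ _).trans (add_le_add h1 h2)) h3)
    _ = _ := by ring

theorem ks_wh (M : Set (Fin 2 → ℤ)) (k) (hk : k ∈ M) (g p m : KE →L[ℂ] KE) (hg : g = p + m)
    (hc : Commute p m) (hm : ksMaps Mᶜ Mᶜ m) :
    ksProj M (NormedSpace.exp g (NormedSpace.exp (-p) (ksProj M (NormedSpace.exp (-m) (ksE k))))) =
      ksE k := by
  let _ : NormedAlgebra ℚ (KE →L[ℂ] KE) := NormedAlgebra.restrictScalars ℚ ℂ _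
  have h1 : NormedSpace.exp g * NormedSpace.exp (-p) = NormedSpace.exp m := by
    rw [← NormedSpace.exp_add_of_commute, hg]
    · congr 1; abel
    · rw [hg]; exact ((Commute.refl p).add_left hc.symm).neg_right
  have h1' : ∀ x, NormedSpace.exp g (NormedSpace.exp (-p) x) = NormedSpace.exp m x := fun x => by
    rw [← h1]; rfl
  have h2 : NormedSpace.exp m (NormedSpace.exp (-m) (ksE k)) = ksE k := by
    have : NormedSpace.exp m * NormedSpace.exp (-m) = 1 := by
      rw [← NormedSpace.exp_add_of_commute (Commute.refl m).neg_right]; simp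
    rw [← mul_apply_eq_comp, this]; rfl
  rw [h1']
  set y := NormedSpace.exp (-m) (ksE k)
  have h3 : NormedSpace.exp m (ksProj M y) = ksE k - NormedSpace.exp m (ksProj Mᶜ y) := by
    rw [eq_sub_iff_add_eq, ← map_add, ← h2]
    congr 1
    ext j
    rw [lp.coeFn_add, Pi.add_apply, ksProj_apply, ksProj_apply]
    by_cases h : j ∈ M <;> simp [h]
  rw [h3]
  ext j
  rw [ksProj_apply]
  split_ifs with h
  · have := hm.exp (ksProj Mᶜ y) (fun j hj => by rw [ksProj_apply, if_neg hj]) j (by simpa using h)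
    rw [lp.coeFn_sub, Pi.sub_apply, this, sub_zero]
  · rw [ksE_apply, if_neg]
    rintro rfl; exact h hk

theorem ksShift_comm (k l) : Commute (ksShift k) (ksShift l) := by
  have h1 := map_mul ksShiftHom (Multiplicative.ofAdd k) (Multiplicative.ofAdd l)
  rw [mul_comm, map_mul] at h1
  exact h1.symm

theorem ksElt_comm (s c s' c') : Commute (ksElt s c) (ksElt s' c') := by
  refine Commute.sum_left _ _ _ fun k _ => Commute.sum_right _ _ _ fun l _ => ?_
  exact ((ksShift_comm k l).smul_left _).smul_right _

theorem ks_local (s : Finset (Fin 2 → ℤ)) (a : (Fin 2 → ℤ) → ℂ) (H : KE →L[ℂ] KE)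
    (hH : H ∈ closure {x | ∃ s c, x = ksElt s c}) (hexp : NormedSpace.exp H = ksElt s a) :
    ∃ (C : ℝ) (ρ : ℤ), 0 < C ∧ 0 ≤ ρ ∧ ∀ M, IsDiscreteHalfSpace M → ∀ k ∈ M, ∃ z : KE,
      (∀ j, z j ≠ 0 → j ∈ M ∧ ∀ i, |j i - k i| ≤ ρ) ∧ ‖z‖ ≤ C ∧
      ‖ksProj M (ksElt s a z) - ksE k‖ ≤ 1 / 2 := by
  classical
  let _ : NormedAlgebra ℚ (KE →L[ℂ] KE) := NormedAlgebra.restrictScalars ℚ ℂ _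
  set c := ‖H‖ + 1
  set K := Real.exp c + 1
  have hK1 : 1 < K := by have := Real.exp_pos c; simp only [K]; linarith
  obtain ⟨δ, hδ0, hδ1, hδ⟩ : ∃ δ : ℝ, 0 < δ ∧ δ ≤ 1 ∧ 3 * δ * K ^ 2 ≤ 1 / 2 := by
    have h1 : 1 ≤ 6 * K ^ 2 := by nlinarith
    refine ⟨1 / (6 * K ^ 2), by positivity, ?_, ?_⟩
    · rw [div_le_one (by positivity)]; exact h1
    · field_simp; norm_num
  obtain ⟨g, ⟨t, γ, rfl⟩, hg1, hg2⟩ : ∃ g ∈ {x | ∃ s c, x = ksElt s c}, ‖g‖ ≤ c ∧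
      ‖NormedSpace.exp H - NormedSpace.exp g‖ ≤ δ := by
    have hcont : Filter.Tendsto (fun g : KE →L[ℂ] KE => NormedSpace.exp H - NormedSpace.exp g)
        (nhds H) (nhds 0) := by
      have : Continuous fun g : KE →L[ℂ] KE => NormedSpace.exp H - NormedSpace.exp g :=
        continuous_const.sub NormedSpace.exp_continuous
      simpa using this.tendsto H
    have h1 := hcont.norm.eventually (gt_mem_nhds (by simpa using hδ0 : ‖(0:KE →L[ℂ] KE)‖ < δ))
    have h2 : ∀ᶠ g : KE →L[ℂ] KE in nhds H, ‖g‖ < c :=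
      (continuous_norm.tendsto H).eventually (gt_mem_nhds (by simp [c]))
    obtain ⟨g, hg, hg'⟩ := ((mem_closure_iff_frequently.1 hH).and_eventually (h1.and h2)).exists
    exact ⟨g, hg, hg'.2.le, hg'.1.le⟩
  obtain ⟨N, hN⟩ := ks_exp_taylor c hδ0
  obtain ⟨D, hD0, hD⟩ := ks_bound t
  refine ⟨K ^ 2, 2 * (N * D), by positivity, by positivity, fun M hM k hk => ?_⟩
  obtain ⟨j0, hM1, hM2⟩ := hM
  set M0 := (fun x => x + j0) '' M
  have hM0 : ∀ x, x ∈ M ↔ x + j0 ∈ M0 := fun x => by simp [M0]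
  set p := ksElt (t.filter (· ∈ M0)) γ
  set m := ksElt (t.filter (· ∉ M0)) γ
  have hgpm : ksElt t γ = p + m := (Finset.sum_filter_add_sum_filter_not _ _ _).symm
  have hpc : ‖-p‖ ≤ c := by
    rw [norm_neg]
    refine (ksElt_norm_le _ _).trans (le_trans ?_ ((ksElt_le_norm t γ).trans hg1))
    exact Finset.sum_le_sum_of_subset_of_nonneg (Finset.filter_subset _ _) fun _ _ _ => norm_nonneg _
  have hmc : ‖-m‖ ≤ c := by
    rw [norm_neg]
    refine (ksElt_norm_le _ _).trans (le_trans ?_ ((ksElt_le_norm t γ).trans hg1))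
    exact Finset.sum_le_sum_of_subset_of_nonneg (Finset.filter_subset _ _) fun _ _ _ => norm_nonneg _
  have hpM : ksMaps M M p := ksMaps_elt fun l hl j hj => by
    rw [hM0] at hj ⊢
    have := hM1 _ hj _ (Finset.mem_filter.1 hl).2
    rwa [add_right_comm] at this
  have hmM : ksMaps Mᶜ Mᶜ m := ksMaps_elt fun l hl j hj => by
    rw [Set.mem_compl_iff, hM0] at hj ⊢
    have := hM2 _ hj _ (Finset.mem_filter.1 hl).2
    rwa [add_right_comm] at this
  have hpB : ∀ u, ksMaps (ksBox k u) (ksBox k (u + D)) (-p) := fun u =>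
    (ksMaps_elt_box (fun l hl => hD l (Finset.mem_filter.1 hl).1) k u).neg
  have hmB : ∀ u, ksMaps (ksBox k u) (ksBox k (u + D)) (-m) := fun u =>
    (ksMaps_elt_box (fun l hl => hD l (Finset.mem_filter.1 hl).1) k u).neg
  have hKe : Real.exp c ≤ K := by simp [K]
  have hx1 := ks_exp_norm _ hpc
  have hx2 := ks_exp_norm _ hmc
  have hw1 : ‖NormedSpace.exp (-p) - ksTaylor N (-p)‖ ≤ δ := hN _ hpc
  have hw2 : ‖NormedSpace.exp (-m) - ksTaylor N (-m)‖ ≤ δ := hN _ hmc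
  rw [norm_sub_rev] at hw1 hw2
  have hw1K : ‖ksTaylor N (-p)‖ ≤ K := by
    have := norm_sub_norm_le (ksTaylor N (-p)) (NormedSpace.exp (-p))
    simp only [K]; linarith
  have hw2K : ‖ksTaylor N (-m)‖ ≤ K := by
    have := norm_sub_norm_le (ksTaylor N (-m)) (NormedSpace.exp (-m))
    simp only [K]; linarith
  have herr := ks_err (ksProj M) (ksElt s a) (NormedSpace.exp (ksElt t γ)) (ksTaylor N (-p))
    (ksTaylor N (-m)) (NormedSpace.exp (-p)) (NormedSpace.exp (-m)) hδ0.le (ksProj_norm M)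
    (by rw [← hexp]; exact hg2) ((ks_exp_norm _ hg1).trans hKe) hw1K hw2K (hx1.trans hKe) hw1 hw2
  have hek : ∀ j ∉ ksBox k 0, ksE k j = 0 := fun j hj => by
    rw [ksE_apply, if_neg]
    rintro rfl
    exact hj fun i => by simp
  refine ⟨ksTaylor N (-p) (ksProj M (ksTaylor N (-m) (ksE k))), fun j hj => ⟨?_, ?_⟩, ?_, ?_⟩
  · by_contra hjM
    exact hj (((hpM.neg.taylor N).mul (ksMaps_proj Set.univ M |>.mono (V' := M) (by simp)))
      (ksTaylor N (-m) (ksE k)) (by simp) j hjM)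
  · have h1 := ksMaps_taylor_box hD0 hmB 0 N
    have h2 := (ksMaps_proj (ksBox k (0 + N * D)) M).mono Set.inter_subset_left
    have h3 := ksMaps_taylor_box hD0 hpB (0 + N * D) N
    have h4 := (h3.mul (h2.mul h1)) (ksE k) hek j
    by_contra hjB
    refine hj (h4 fun hh => hjB fun i => (hh i).trans (by linarith))
  · calc _ ≤ ‖ksTaylor N (-p)‖ * (‖ksProj M‖ * (‖ksTaylor N (-m)‖ * ‖ksE k‖)) :=
        ContinuousLinearMap.le_opNorm_of_le _ (ContinuousLinearMap.le_opNorm_of_le _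
          (ContinuousLinearMap.le_opNorm _ _))
      _ ≤ K * (1 * (K * 1)) := by
        rw [ksE_norm]
        gcongr
        exact ksProj_norm M
      _ = _ := by ring
  · have hwh := ks_wh M k hk _ p m hgpm (ksElt_comm _ _ _ _) hmM
    have := ContinuousLinearMap.le_opNorm (ksProj M * (ksElt s a * ksTaylor N (-p) * ksProj M * ksTaylor N (-m)) -
      ksProj M * (NormedSpace.exp (ksElt t γ) * NormedSpace.exp (-p) * ksProj M * NormedSpace.exp (-m))) (ksE k)
    rw [ksE_norm, mul_one] at this
    refine le_trans (le_of_eq ?_) (this.trans (herr.trans hδ))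
    congr 1
    exact congrArg (fun y => ksProj M (ksElt s a (ksTaylor N (-p) (ksProj M (ksTaylor N (-m) (ksE k))))) - y) hwh.symm

theorem ks_fin_mat {ι : Type*} [Fintype ι] [DecidableEq ι] (A B : Matrix ι ι ℂ) {C : ℝ} (hC : 0 ≤ C)
    (hB : ∀ k, ∑ i, ‖B i k‖ ≤ C) (hE : ∀ k, ∑ j, ‖(A * B - 1) j k‖ ≤ 1 / 2) :
    (∀ y : ι → ℂ, ∃ x, A.mulVec x = y ∧ ∑ i, ‖x i‖ ≤ 2 * C * ∑ i, ‖y i‖) ∧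
    (∀ x x', A.mulVec x = A.mulVec x' → x = x') := by
  have key : ∀ (D : Matrix ι ι ℂ) (c : ℝ), (∀ k, ∑ i, ‖D i k‖ ≤ c) → ∀ w : ι → ℂ,
      ∑ i, ‖D.mulVec w i‖ ≤ c * ∑ i, ‖w i‖ := by
    intro D c hD w
    calc _ ≤ ∑ i, ∑ k, ‖D i k‖ * ‖w k‖ := by
          refine Finset.sum_le_sum fun i _ => ?_
          refine (norm_sum_le _ _).trans (Finset.sum_le_sum fun k _ => ?_)
          rw [norm_mul]
      _ = ∑ k, (∑ i, ‖D i k‖) * ‖w k‖ := by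
          rw [Finset.sum_comm]; simp_rw [Finset.sum_mul]
      _ ≤ ∑ k, c * ‖w k‖ := by
          refine Finset.sum_le_sum fun k _ => ?_
          gcongr; exact hD k
      _ = _ := by rw [Finset.mul_sum]
  have h2 : ∀ w : ι → ℂ, ∑ i, ‖w i‖ ≤ 2 * ∑ i, ‖(A * B).mulVec w i‖ := by
    intro w
    have h3 := key _ _ hE w
    have h4 : ∑ i, ‖w i‖ ≤ ∑ i, ‖(A * B).mulVec w i‖ + ∑ i, ‖(A * B - 1).mulVec w i‖ := by
      rw [← Finset.sum_add_distrib]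
      refine Finset.sum_le_sum fun i _ => ?_
      rw [Matrix.sub_mulVec, Matrix.one_mulVec, Pi.sub_apply]
      have := norm_sub_le ((A * B).mulVec w i) ((A * B).mulVec w i - w i)
      simpa using this
    linarith
  have hinj : Function.Injective (A * B).mulVec := by
    intro w w' h
    have h3 := h2 (w - w')
    rw [Matrix.mulVec_sub, h, sub_self] at h3
    simp only [Pi.zero_apply, norm_zero, Finset.sum_const_zero, mul_zero] at h3
    have h4 := (Finset.sum_eq_zero_iff_of_nonneg (fun i _ => norm_nonneg _)).1
      (le_antisymm h3 (Finset.sum_nonneg fun i _ => norm_nonneg _))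
    ext i
    have := h4 i (Finset.mem_univ i)
    simpa [sub_eq_zero] using this
  have hu := Matrix.mulVec_injective_iff_isUnit.1 hinj
  have hA : IsUnit A := by
    rw [Matrix.isUnit_iff_isUnit_det, Matrix.det_mul] at hu
    rw [Matrix.isUnit_iff_isUnit_det]
    exact isUnit_of_mul_isUnit_left hu
  refine ⟨fun y => ?_, fun x x' h => Matrix.mulVec_injective_iff_isUnit.2 hA h⟩
  obtain ⟨w, hw⟩ := Matrix.mulVec_surjective_iff_isUnit.2 hu y
  refine ⟨B.mulVec w, by rw [Matrix.mulVec_mulVec, hw], ?_⟩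
  have h3 := key B C hB w
  have h4 := h2 w
  rw [hw] at h4
  nlinarith

theorem ks_fin (s : Finset (Fin 2 → ℤ)) (a : (Fin 2 → ℤ) → ℂ) (hs : ∀ k, k ∉ s → a k = 0)
    {C : ℝ} (hC : 0 < C) {ρ d : ℤ} (hρ : 0 ≤ ρ) (hd : 0 ≤ d) (hsd : ∀ k ∈ s, ∀ i, |k i| ≤ d)
    (hloc : ∀ M, IsDiscreteHalfSpace M → ∀ k ∈ M, ∃ z : KE,
      (∀ j, z j ≠ 0 → j ∈ M ∧ ∀ i, |j i - k i| ≤ ρ) ∧ ‖z‖ ≤ C ∧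
      ‖ksProj M (ksElt s a z) - ksE k‖ ≤ 1 / 2)
    (Q : Set (Fin 2 → ℤ)) (hQf : Q.Finite)
    (hQ : ∀ k ∈ Q, ∃ M, IsDiscreteHalfSpace M ∧ ∀ j : Fin 2 → ℤ, (∀ i, |j i - k i| ≤ ρ + d) → (j ∈ Q ↔ j ∈ M))
    (y : (Fin 2 → ℤ) → ℂ) (hy : Function.support y ⊆ Q) :
    ∃ x : (Fin 2 → ℤ) → ℂ,
      (Function.support x ⊆ Q ∧
        (∀ j : Fin 2 → ℤ, j ∈ Q → (∑ᶠ k : Fin 2 → ℤ, a (j - k) * x k) = y j) ∧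
        (∑ᶠ j : Fin 2 → ℤ, ‖x j‖) ≤ 2 * C * ∑ᶠ j : Fin 2 → ℤ, ‖y j‖) ∧
      (∀ x' : (Fin 2 → ℤ) → ℂ, Function.support x' ⊆ Q →
        (∀ j : Fin 2 → ℤ, j ∈ Q → (∑ᶠ k : Fin 2 → ℤ, a (j - k) * x' k) = y j) → x' = x) := by
  classical
  obtain ⟨Q, rfl⟩ : ∃ F : Finset (Fin 2 → ℤ), Q = ↑F := ⟨hQf.toFinset, by simp⟩
  simp only [Finset.mem_coe] at *
  have hz : ∀ k ∈ Q, ∃ z : (Fin 2 → ℤ) → ℂ, ∑ i ∈ Q, ‖z i‖ ≤ C ∧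
      ∑ j ∈ Q, ‖∑ i ∈ Q, a (j - i) * z i - (if j = k then 1 else 0)‖ ≤ 1 / 2 := by
    intro k hk
    obtain ⟨M, hM, hQM⟩ := hQ k hk
    have hkM : k ∈ M := (hQM k (fun i => by simp; omega)).1 hk
    obtain ⟨z, hz1, hz2, hz3⟩ := hloc M hM k hkM
    refine ⟨z, (KE.sum_le z Q).trans hz2, le_trans (Finset.sum_le_sum fun j hj => ?_)
      ((KE.sum_le _ Q).trans hz3)⟩
    have hzQ : ∀ i, z i ≠ 0 → i ∈ Q := fun i hi =>
      (hQM i fun l => ((hz1 i hi).2 l).trans (by omega)).2 (hz1 i hi).1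
    have hsum : ∑ i ∈ Q, a (j - i) * z i = ksElt s a z j := by
      rw [ksElt_apply]
      symm
      refine Finset.sum_bij_ne_zero (fun l _ _ => j - l) ?_ ?_ ?_ ?_
      · intro l _ h
        exact hzQ _ (right_ne_zero_of_mul h)
      · intro l _ _ l' _ _ h
        simpa using h
      · intro i _ h
        refine ⟨j - i, ?_, ?_, by simp⟩
        · by_contra hh; exact h (by rw [hs _ hh, zero_mul])
        · simpa using h
      · intro l _ _; simp
    rw [hsum, lp.coeFn_sub, Pi.sub_apply, ksE_apply, ksProj_apply]
    split_ifs with h1 h2 h2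
    · exact le_rfl
    · exact absurd (h1 ▸ hkM) h2
    · exact le_rfl
    · have : ksElt s a z j = 0 := by
        rw [ksElt_apply]
        refine Finset.sum_eq_zero fun l hl => ?_
        by_contra hne
        have h3 := hz1 _ (right_ne_zero_of_mul hne)
        refine h2 ((hQM j fun i => ?_).1 hj)
        have h4 := h3.2 i
        have h5 := hsd l hl i
        simp only [Pi.sub_apply] at h4
        rw [abs_le] at *
        omega
      simp [this]
  choose! Z hZ1 hZ2 using hz
  obtain ⟨hex, hun⟩ := ks_fin_mat (ι := Q) (Matrix.of fun j i => a (j - i)) (Matrix.of fun i k => Z k i) hC.le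
    (fun k => by
      simp only [Matrix.of_apply]
      rw [Finset.sum_coe_sort Q (fun i => ‖Z k i‖)]; exact hZ1 k k.2)
    (fun k => by
      refine le_trans (le_of_eq ?_) (hZ2 k k.2)
      rw [← Finset.sum_coe_sort Q]
      refine Finset.sum_congr rfl fun j _ => ?_
      rw [Matrix.sub_apply, Matrix.mul_apply, Matrix.one_apply, ← Finset.sum_coe_sort Q]
      simp only [Subtype.ext_iff, Matrix.of_apply])
  have hfs : ∀ (f : (Fin 2 → ℤ) → ℂ), Function.support f ⊆ Q → ∀ j,
      ∑ᶠ k, a (j - k) * f k = ∑ k : Q, a (j - k) * f k := by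
    intro f hf j
    rw [Finset.sum_coe_sort Q (fun k => a (j - k) * f k)]
    refine finsum_eq_sum_of_support_subset _ fun k hk => hf (right_ne_zero_of_mul hk)
  have hfn : ∀ (f : (Fin 2 → ℤ) → ℂ), Function.support f ⊆ Q →
      ∑ᶠ k, ‖f k‖ = ∑ k : Q, ‖f k‖ := by
    intro f hf
    rw [Finset.sum_coe_sort Q (fun k => ‖f k‖)]
    refine finsum_eq_sum_of_support_subset _ fun k hk => hf (by simpa using hk)
  obtain ⟨x, hx1, hx2⟩ := hex (fun j => y j)
  set X : (Fin 2 → ℤ) → ℂ := fun k => if h : k ∈ Q then x ⟨k, h⟩ else 0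
  have hXQ : ∀ k : Q, X k = x k := fun k => by simp [X]
  have hXs : Function.support X ⊆ Q := by
    intro k hk
    by_contra hh
    exact hk (dif_neg hh)
  refine ⟨X, ⟨hXs, fun j hj => ?_, ?_⟩, fun x' hx' h' => ?_⟩
  · rw [hfs X hXs]
    simp only [hXQ]
    exact congrFun hx1 ⟨j, hj⟩
  · rw [hfn X hXs, hfn y hy]
    simp only [hXQ]
    exact hx2
  · have := hun (fun k => x' k) x (by
      rw [hx1]
      ext j
      have := h' j j.2
      rw [hfs x' hx'] at this
      exact this)
    ext k
    by_cases hk : k ∈ Q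
    · rw [← this] at hXQ
      exact (hXQ ⟨k, hk⟩).symm
    · rw [Function.notMem_support.1 (fun h => hk (hx' h)), Function.notMem_support.1 (fun h => hk (hXs h))]

def ksD (G : ℤ) : ℕ → ℤ
  | 0 => 0
  | n + 1 => 3 * ksD G n + 3 * G + 1

theorem ksD_nonneg {G : ℤ} (hG : 0 ≤ G) (n : ℕ) : 0 ≤ ksD G n := by
  induction n with
  | zero => simp [ksD]
  | succ n ih => simp only [ksD]; omega

def ksReg {α : Type*} [Ring α] [LE α] (G : ℤ) : ℕ → α → α → Prop
  | 0, p, q => 0 ≤ p ∧ 0 ≤ q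
  | n + 1, p, q => ksReg G n p (p + q - ((2 * ksD G n + 3 * G + 1 : ℤ) : α)) ∧
      ksReg G n (p + q - ((2 * ksD G n + 3 * G + 1 : ℤ) : α)) q

theorem ksReg_cast (G : ℤ) (n : ℕ) (p q : ℤ) : ksReg G n (p : ℝ) (q : ℝ) ↔ ksReg G n p q := by
  induction n generalizing p q with
  | zero => simp [ksReg]
  | succ n ih =>
    simp only [ksReg]
    rw [← ih, ← ih]
    push_cast
    rfl

theorem ksReg_nonneg (G : ℤ) (n : ℕ) (p q : ℤ) (h : ksReg G n p q) : 0 ≤ p ∧ 0 ≤ q := by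
  induction n generalizing p q with
  | zero => exact h
  | succ n ih => exact ⟨(ih _ _ h.1).1, (ih _ _ h.2).2⟩

theorem ksReg_of {G : ℤ} (hG : 0 ≤ G) (n : ℕ) (p q : ℤ) :
    (0 ≤ p → ksD G n ≤ q → ksReg G n p q) ∧ (ksD G n ≤ p → 0 ≤ q → ksReg G n p q) := by
  induction n generalizing p q with
  | zero => simp only [ksD, ksReg]; tauto
  | succ n ih =>
    have h0 := ksD_nonneg hG n
    simp only [ksD, ksReg, Int.cast_id]
    exact ⟨fun h1 h2 => ⟨(ih _ _).1 (by omega) (by omega), (ih _ _).1 (by omega) (by omega)⟩,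
      fun h1 h2 => ⟨(ih _ _).2 (by omega) (by omega), (ih _ _).2 (by omega) (by omega)⟩⟩

theorem ksReg_convex (G : ℤ) (n : ℕ) (s t p q p' q' : ℝ) (hs : 0 ≤ s) (ht : 0 ≤ t) (hst : s + t = 1)
    (h : ksReg G n p q) (h' : ksReg G n p' q') : ksReg G n (s * p + t * p') (s * q + t * q') := by
  induction n generalizing p q p' q' with
  | zero =>
    obtain ⟨h1, h2⟩ := h
    obtain ⟨h3, h4⟩ := h'
    exact ⟨by positivity, by positivity⟩
  | succ n ih =>
    simp only [ksReg] at *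
    generalize ((2 * ksD G n + 3 * G + 1 : ℤ) : ℝ) = T at *
    have e : s * (p + q - T) + t * (p' + q' - T) = s * p + t * p' + (s * q + t * q') - T := by
      linear_combination (-T) * hst
    rw [← e]
    exact ⟨ih _ _ _ _ h.1 h'.1, ih _ _ _ _ h.2 h'.2⟩

theorem ks_half (u v : (Fin 2 → ℤ) →+ ℤ) (hsurj : ∀ α β : ℤ, ∃ j, u j = α ∧ v j = β) (α β : ℤ) :
    IsDiscreteHalfSpace {m | 0 < α - u m ∨ (α - u m = 0 ∧ 0 ≤ β - v m)} := by
  obtain ⟨j, hj1, hj2⟩ := hsurj (-α) (-β)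
  refine ⟨j, ?_⟩
  have e : ((fun x => x + j) '' {m | 0 < α - u m ∨ (α - u m = 0 ∧ 0 ≤ β - v m)}) =
      {x | u x < 0 ∨ (u x = 0 ∧ v x ≤ 0)} := by
    ext x
    rw [Set.image_add_right]
    simp only [Set.mem_preimage, Set.mem_setOf_eq, map_add, map_neg, hj1, hj2]
    omega
  rw [e]
  refine ⟨fun x hx y hy => ?_, fun x hx y hy => ?_⟩ <;>
  · simp only [Set.mem_setOf_eq, map_add] at *
    omega

theorem ks_geo_loc {G : ℤ} (hG : 0 ≤ G) (S : Set (Fin 2 → ℤ)) (n : ℕ) :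
    ∀ (u v : (Fin 2 → ℤ) →+ ℤ) (α β : ℤ),
    (∀ m ∈ S, ∀ m' ∈ S, |u (m - m')| * 2 ^ n ≤ G ∧ |v (m - m')| * 2 ^ n ≤ G) →
    (∀ m ∈ S, ∀ m' ∈ S, u (m - m') ≤ -1 → 1 ≤ v (m - m') → v (m - m') - u (m - m') ≤ n + 1) →
    (∀ α β : ℤ, ∃ j, u j = α ∧ v j = β) →
    ∃ M, IsDiscreteHalfSpace M ∧ ∀ m ∈ S, (ksReg G n (α - u m) (β - v m) ↔ m ∈ M) := by
  induction n with
  | zero =>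
    intro u v α β h1 h2 h3
    by_cases hb : ∃ m ∈ S, 0 < α - u m ∧ β - v m < 0
    · obtain ⟨m1, hm1, hb1, hb2⟩ := hb
      refine ⟨_, ks_half v u (fun a b => by obtain ⟨j, h, h'⟩ := h3 b a; exact ⟨j, h', h⟩) β α, fun m hm => ?_⟩
      have := h2 m1 hm1 m hm
      simp only [map_sub] at this
      simp only [ksReg, Set.mem_setOf_eq]
      push_cast at this
      omega
    · refine ⟨_, ks_half u v h3 α β, fun m hm => ?_⟩
      have : ¬ (0 < α - u m ∧ β - v m < 0) := fun h => hb ⟨m, hm, h⟩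
      simp only [ksReg, Set.mem_setOf_eq]
      omega
  | succ n ih =>
    intro u v α β h1 h2 h3
    have hp : (0:ℤ) < 2 ^ n := by positivity
    set T : ℤ := 2 * ksD G n + 3 * G + 1 with hT
    have hw1 : ∀ m ∈ S, ∀ m' ∈ S, |u (m - m')| * 2 ^ n ≤ G ∧ |v (m - m')| * 2 ^ n ≤ G ∧
        |(u + v) (m - m')| * 2 ^ n ≤ G := by
      intro m hm m' hm'
      obtain ⟨ha, hb⟩ := h1 m hm m' hm'
      rw [pow_succ] at ha hb
      have hc := abs_add_le (u (m - m')) (v (m - m'))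
      have := abs_nonneg (u (m - m'))
      have := abs_nonneg (v (m - m'))
      rw [AddMonoidHom.add_apply]
      refine ⟨?_, ?_, ?_⟩ <;> nlinarith
    have hs : ∀ m, α - u m + (β - v m) - T = (α + β - T) - (u + v) m := by
      intro m; rw [AddMonoidHom.add_apply]; ring
    by_cases hA : ∀ m ∈ S, ksD G n ≤ α - u m
    · obtain ⟨M, hM, hM'⟩ := ih (u + v) v (α + β - T) β
        (fun m hm m' hm' => ⟨(hw1 m hm m' hm').2.2, (hw1 m hm m' hm').2.1⟩)
        (fun m hm m' hm' ha hb => by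
          have := h2 m hm m' hm'
          rw [AddMonoidHom.add_apply] at *
          push_cast at this
          omega)
        (fun a b => by
          obtain ⟨j, hj, hj'⟩ := h3 (a - b) b
          exact ⟨j, by rw [AddMonoidHom.add_apply]; omega, hj'⟩)
      refine ⟨M, hM, fun m hm => ?_⟩
      rw [← hM' m hm]
      simp only [ksReg, Int.cast_id, ← hT, hs]
      refine ⟨fun h => h.2, fun h => ⟨?_, h⟩⟩
      exact (ksReg_of hG n _ _).2 (hA m hm) (ksReg_nonneg _ _ _ _ h).1
    by_cases hB : ∀ m ∈ S, ksD G n ≤ β - v m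
    · obtain ⟨M, hM, hM'⟩ := ih u (u + v) α (α + β - T)
        (fun m hm m' hm' => ⟨(hw1 m hm m' hm').1, (hw1 m hm m' hm').2.2⟩)
        (fun m hm m' hm' ha hb => by
          have := h2 m hm m' hm'
          rw [AddMonoidHom.add_apply] at *
          push_cast at this
          omega)
        (fun a b => by
          obtain ⟨j, hj, hj'⟩ := h3 a (b - a)
          exact ⟨j, hj, by rw [AddMonoidHom.add_apply]; omega⟩)
      refine ⟨M, hM, fun m hm => ?_⟩
      rw [← hM' m hm]
      simp only [ksReg, Int.cast_id, ← hT, hs]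
      refine ⟨fun h => h.1, fun h => ⟨h, ?_⟩⟩
      exact (ksReg_of hG n _ _).1 (ksReg_nonneg _ _ _ _ h).2 (hB m hm)
    push Not at hA hB
    obtain ⟨m1, hm1, hA⟩ := hA
    obtain ⟨m2, hm2, hB⟩ := hB
    refine ⟨∅, ⟨0, by simp [IsCanonicalDiscreteHalfSpace]⟩, fun m hm => ?_⟩
    simp only [Set.mem_empty_iff_false, iff_false]
    intro h
    have h4 := (ksReg_nonneg _ _ _ _ h.1).2
    simp only [Int.cast_id] at h4
    have h5 := (hw1 m1 hm1 m hm).1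
    have h6 := (hw1 m2 hm2 m hm).2.1
    have h7 : |u (m1 - m)| ≤ G := by nlinarith [abs_nonneg (u (m1 - m))]
    have h8 : |v (m2 - m)| ≤ G := by nlinarith [abs_nonneg (v (m2 - m))]
    rw [map_sub, abs_le] at h7 h8
    omega

def ksK {α : Type*} [Ring α] [LE α] (G : ℤ) (N : ℕ) (c x y : α) : Prop :=
  ksReg G N (c - x) (c - y) ∧ ksReg G N (c - x) (c + y) ∧
  ksReg G N (c + x) (c - y) ∧ ksReg G N (c + x) (c + y)

theorem ksK_cast (G : ℤ) (n : ℕ) (c p q : ℤ) : ksK G n (c : ℝ) (p : ℝ) (q : ℝ) ↔ ksK G n c p q := by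
  simp only [ksK, ← ksReg_cast]
  push_cast
  rfl

theorem ks_corner {ρ G : ℤ} {N : ℕ} (hρ : 0 ≤ ρ) (hN : (N : ℤ) = 2 * ρ) (hG : G = ρ * 2 ^ N)
    (S : Set (Fin 2 → ℤ)) (hS : ∀ m ∈ S, ∀ m' ∈ S, ∀ i, |m i - m' i| ≤ ρ) (c σ τ : ℤ)
    (hσ : σ = 1 ∨ σ = -1) (hτ : τ = 1 ∨ τ = -1) :
    ∃ M, IsDiscreteHalfSpace M ∧ ∀ m ∈ S, (ksReg G N (c - σ * m 0) (c - τ * m 1) ↔ m ∈ M) := by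
  have hp : (0:ℤ) < 2 ^ N := by positivity
  have hG0 : 0 ≤ G := by rw [hG]; positivity
  refine ks_geo_loc hG0 S N (σ • Pi.evalAddMonoidHom (fun _ : Fin 2 => ℤ) 0)
    (τ • Pi.evalAddMonoidHom (fun _ : Fin 2 => ℤ) 1) c c ?_ ?_ ?_
  · intro m hm m' hm'
    have h0 := hS m hm m' hm' 0
    have h1 := hS m hm m' hm' 1
    simp only [AddMonoidHom.smul_apply, Pi.evalAddMonoidHom_apply, Pi.sub_apply, smul_eq_mul, abs_mul]
    have e1 : |σ| = 1 := by rcases hσ with rfl | rfl <;> simp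
    have e2 : |τ| = 1 := by rcases hτ with rfl | rfl <;> simp
    rw [e1, e2, hG, one_mul, one_mul]
    exact ⟨by gcongr, by gcongr⟩
  · intro m hm m' hm' _ _
    have h0 := hS m hm m' hm' 0
    have h1 := hS m hm m' hm' 1
    simp only [AddMonoidHom.smul_apply, Pi.evalAddMonoidHom_apply, Pi.sub_apply, smul_eq_mul]
    rw [abs_le] at h0 h1
    rcases hσ with rfl | rfl <;> rcases hτ with rfl | rfl <;> omega
  · intro a b
    refine ⟨![σ * a, τ * b], ?_⟩
    rcases hσ with rfl | rfl <;> rcases hτ with rfl | rfl <;> simp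

theorem ks_geo_top {ρ G : ℤ} {N : ℕ} (hρ : 0 ≤ ρ) (hN : (N : ℤ) = 2 * ρ) (hG : G = ρ * 2 ^ N)
    (S : Set (Fin 2 → ℤ)) (hS : ∀ m ∈ S, ∀ m' ∈ S, ∀ i, |m i - m' i| ≤ ρ) (c : ℤ)
    (hc : 2 * ksD G N + ρ ≤ 2 * c) :
    ∃ M, IsDiscreteHalfSpace M ∧ ∀ m ∈ S, (ksK G N c (m 0) (m 1) ↔ m ∈ M) := by
  have hG0 : 0 ≤ G := by rw [hG]; positivity
  have hD := ksD_nonneg hG0 N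
  have hcase : ∀ i, (∃ σ : ℤ, (σ = 1 ∨ σ = -1) ∧ ∀ m ∈ S, ksD G N ≤ c + σ * m i) := by
    intro i
    by_cases h : ∀ m ∈ S, ksD G N ≤ c + m i
    · exact ⟨1, by simp, by simpa using h⟩
    · push Not at h
      obtain ⟨m, hm, h⟩ := h
      refine ⟨-1, by simp, fun m' hm' => ?_⟩
      have := hS m hm m' hm' i
      rw [abs_le] at this
      omega
  obtain ⟨σ, hσ, h0⟩ := hcase 0
  obtain ⟨τ, hτ, h1⟩ := hcase 1
  obtain ⟨M, hM, hM'⟩ := ks_corner hρ hN hG S hS c σ τ hσ hτ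
  refine ⟨M, hM, fun m hm => ?_⟩
  rw [← hM' m hm]
  have h0 := h0 m hm
  have h1 := h1 m hm
  have key : ksReg G N (c - σ * m 0) (c - τ * m 1) → ksReg G N (c - σ * m 0) (c + τ * m 1) ∧
      ksReg G N (c + σ * m 0) (c - τ * m 1) ∧ ksReg G N (c + σ * m 0) (c + τ * m 1) := by
    intro h
    have h2 := ksReg_nonneg _ _ _ _ h
    exact ⟨(ksReg_of hG0 N _ _).1 h2.1 h1, (ksReg_of hG0 N _ _).2 h0 h2.2,
      (ksReg_of hG0 N _ _).2 h0 (hD.trans h1)⟩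
  unfold ksK
  rcases hσ with rfl | rfl <;> rcases hτ with rfl | rfl <;>
    simp only [one_mul, neg_mul, sub_neg_eq_add, ← sub_eq_add_neg] at * <;> tauto

theorem latticeCoe_apply (k : Fin 2 → ℤ) (i : Fin 2) : latticeCoe k i = (k i : ℝ) := rfl

def ksPoly (G : ℤ) (N : ℕ) (c : ℤ) : Set (EuclideanSpace ℝ (Fin 2)) :=
  convexHull ℝ (latticeCoe '' {k | ksK G N c (k 0) (k 1)})

theorem ksK_finite (G : ℤ) (N : ℕ) (c : ℤ) : {k : Fin 2 → ℤ | ksK G N c (k 0) (k 1)}.Finite := by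
  refine (Set.finite_Icc (fun _ : Fin 2 => -c) (fun _ => c)).subset fun k hk => ?_
  have h1 := ksReg_nonneg _ _ _ _ hk.1
  have h2 := ksReg_nonneg _ _ _ _ hk.2.2.2
  refine ⟨fun i => ?_, fun i => ?_⟩ <;> fin_cases i <;> simp <;> omega

theorem ksPoly_mem (G : ℤ) (N : ℕ) (c : ℤ) (k : Fin 2 → ℤ) :
    latticeCoe k ∈ ksPoly G N c ↔ ksK G N c (k 0) (k 1) := by
  refine ⟨fun h => ?_, fun h => subset_convexHull ℝ _ ⟨k, h, rfl⟩⟩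
  have : ksPoly G N c ⊆ {x : EuclideanSpace ℝ (Fin 2) | ksK G N (c : ℝ) (x 0) (x 1)} := by
    refine convexHull_min ?_ ?_
    · rintro _ ⟨k, hk, rfl⟩
      exact (ksK_cast _ _ _ _ _).2 hk
    · rintro x ⟨hx1, hx2, hx3, hx4⟩ y ⟨hy1, hy2, hy3, hy4⟩ s t hs ht hst
      have e1 : ∀ i, (c : ℝ) - (s • x + t • y) i = s * (c - x i) + t * (c - y i) := fun i => by
        simp only [PiLp.add_apply, PiLp.smul_apply, smul_eq_mul]
        linear_combination (-(c : ℝ)) * hst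
      have e2 : ∀ i, (c : ℝ) + (s • x + t • y) i = s * (c + x i) + t * (c + y i) := fun i => by
        simp only [PiLp.add_apply, PiLp.smul_apply, smul_eq_mul]
        linear_combination (-(c : ℝ)) * hst
      simp only [Set.mem_setOf_eq, ksK, e1, e2]
      exact ⟨ksReg_convex _ _ _ _ _ _ _ _ hs ht hst hx1 hy1,
        ksReg_convex _ _ _ _ _ _ _ _ hs ht hst hx2 hy2,
        ksReg_convex _ _ _ _ _ _ _ _ hs ht hst hx3 hy3,
        ksReg_convex _ _ _ _ _ _ _ _ hs ht hst hx4 hy4⟩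
  exact (ksK_cast _ _ _ _ _).1 (this h)

theorem ks_square (P : Set (EuclideanSpace ℝ (Fin 2))) (hP : Convex ℝ P) (m : ℤ) (hm : 0 < m)
    (hc : ∀ σ τ : ℤ, (σ = 1 ∨ σ = -1) → (τ = 1 ∨ τ = -1) → latticeCoe ![σ * m, τ * m] ∈ P)
    (x : EuclideanSpace ℝ (Fin 2)) (hx : ∀ i, |x i| ≤ m) : x ∈ P := by
  have hm' : (0:ℝ) < m := by exact_mod_cast hm
  have hx0 := abs_le.1 (hx 0)
  have hx1 := abs_le.1 (hx 1)
  have h1 : ∀ τ : ℤ, (τ = 1 ∨ τ = -1) → !₂[x 0, (τ * m : ℝ)] ∈ P := by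
    intro τ hτ
    have := hP (hc 1 τ (by simp) hτ) (hc (-1) τ (by simp) hτ)
      (a := (m + x 0) / (2 * m)) (b := (m - x 0) / (2 * m))
      (div_nonneg (by linarith) (by linarith)) (div_nonneg (by linarith) (by linarith))
      (by field_simp; ring)
    convert this using 1
    ext i
    fin_cases i
    · simp [latticeCoe_apply]; field_simp; ring
    · simp [latticeCoe_apply]; field_simp; ring
  have := hP (h1 1 (by simp)) (h1 (-1) (by simp))
      (a := (m + x 1) / (2 * m)) (b := (m - x 1) / (2 * m))
      (div_nonneg (by linarith) (by linarith)) (div_nonneg (by linarith) (by linarith))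
      (by field_simp; ring)
  convert this using 1
  ext i
  fin_cases i
  · simp; field_simp; ring
  · simp; field_simp; ring

theorem ksPoly_square {G : ℤ} (hG : 0 ≤ G) (N : ℕ) (c : ℤ) (m : ℤ) (hm : 0 < m) (hmc : m + ksD G N ≤ c)
    (x : EuclideanSpace ℝ (Fin 2)) (hx : ∀ i, |x i| ≤ m) : x ∈ ksPoly G N c := by
  refine ks_square (ksPoly G N c) (convex_convexHull ℝ _) m hm (fun σ τ hσ hτ => ?_) x hx
  rw [ksPoly_mem]
  have hD := ksD_nonneg hG N
  have key : ∀ p q : ℤ, ksD G N ≤ p → ksD G N ≤ q → ksReg G N p q := fun p q h h' =>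
    (ksReg_of hG N p q).1 (by omega) h'
  unfold ksK
  simp only [Matrix.cons_val_zero, Matrix.cons_val_one]
  rcases hσ with rfl | rfl <;> rcases hτ with rfl | rfl <;>
    exact ⟨key _ _ (by omega) (by omega), key _ _ (by omega) (by omega),
      key _ _ (by omega) (by omega), key _ _ (by omega) (by omega)⟩

theorem ks_geo (r : ℤ) (hr : 0 < r) : ∃ P : ℕ → Set (EuclideanSpace ℝ (Fin 2)),
    (∀ n, MemKS r 1 (P n)) ∧
    (∀ K : Set (EuclideanSpace ℝ (Fin 2)), Bornology.IsBounded K → ∃ N : ℕ, ∀ n ≥ N, K ⊆ P n) ∧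
    (∀ n, {k : Fin 2 → ℤ | latticeCoe k ∈ P n}.Finite) := by
  obtain ⟨N, hN⟩ : ∃ N : ℕ, (N : ℤ) = 2 * (2 * r) := ⟨(2 * (2 * r)).toNat, by omega⟩
  set G : ℤ := (2 * r) * 2 ^ N with hG
  have hG0 : 0 ≤ G := by rw [hG]; positivity
  have hD := ksD_nonneg hG0 N
  refine ⟨fun n => ksPoly G N (ksD G N + 2 * r + 1 + n), fun n => ⟨?_, fun x => ?_, ?_⟩, ?_, ?_⟩
  · exact ⟨(ksK_finite G N _).toFinset, by rw [Set.Finite.coe_toFinset]; rfl⟩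
  · obtain ⟨M, hM, hM'⟩ := ks_geo_top (by omega) hN hG {k | latticeCoe k ∈ Metric.ball x r} (by
      intro m hm m' hm' i
      have h1 : ∀ m, latticeCoe m ∈ Metric.ball x r → |(m i : ℝ) - x i| ≤ r := fun m hm => by
        rw [Metric.mem_ball, dist_eq_norm] at hm
        exact (PiLp.norm_apply_le (latticeCoe m - x) i).trans hm.le
      have h2 := abs_le.1 (h1 m hm)
      have h3 := abs_le.1 (h1 m' hm')
      have : |(m i : ℝ) - m' i| ≤ 2 * r := by
        rw [abs_le]; constructor <;> linarith
      exact_mod_cast this) (ksD G N + 2 * r + 1 + n) (by omega)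
    refine ⟨M, hM, ?_⟩
    ext k
    simp only [Set.mem_setOf_eq, ksPoly_mem]
    exact and_congr_left fun hk => hM' k hk
  · intro x hx
    refine ksPoly_square hG0 N _ 1 (by omega) (by omega) x fun i => ?_
    rw [Metric.mem_ball, dist_zero_right] at hx
    rw [Int.cast_one]
    exact (PiLp.norm_apply_le x i).trans hx.le
  · intro K hK
    obtain ⟨B, hB⟩ := hK.exists_norm_le
    obtain ⟨n0, hn0⟩ := exists_nat_ge B
    refine ⟨n0, fun n hn x hx => ?_⟩
    refine ksPoly_square hG0 N _ (n + 1) (by omega) (by omega) x fun i => ?_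
    have h1 := PiLp.norm_apply_le x i
    have h2 := hB x hx
    have h3 : (n0 : ℝ) ≤ n := by exact_mod_cast hn
    rw [Real.norm_eq_abs] at h1
    push_cast
    linarith
  · intro n
    simp only [ksPoly_mem]
    exact ksK_finite G N _

theorem kozak_simonenko
    (a : (Fin 2 → ℤ) → ℂ) (ha : (Function.support a).Finite)
    (hs : ∀ θ : Fin 2 → ℝ, ksSymbol a θ ≠ 0)
    (hindex : ∃ h : (Fin 2 → ℝ) → ℂ, Continuous h ∧
      (∀ (θ : Fin 2 → ℝ) (i : Fin 2),
        h (Function.update θ i (θ i + 2 * Real.pi)) = h θ) ∧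
      (∀ θ : Fin 2 → ℝ, ksSymbol a θ = Complex.exp (h θ))) :
    ∃ r R c : ℝ, 0 < r ∧ 0 < R ∧ 0 < c ∧
      ∃ P : ℕ → Set (EuclideanSpace ℝ (Fin 2)),
        (∀ n, MemKS r R (P n)) ∧
        (∀ K : Set (EuclideanSpace ℝ (Fin 2)), Bornology.IsBounded K →
          ∃ N : ℕ, ∀ n ≥ N, K ⊆ P n) ∧
        (∀ n, {k : Fin 2 → ℤ | latticeCoe k ∈ P n}.Finite ∧
          ∀ y : (Fin 2 → ℤ) → ℂ,
            Function.support y ⊆ {k : Fin 2 → ℤ | latticeCoe k ∈ P n} →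
            ∃ x : (Fin 2 → ℤ) → ℂ,
              (Function.support x ⊆ {k : Fin 2 → ℤ | latticeCoe k ∈ P n} ∧
                (∀ j : Fin 2 → ℤ, latticeCoe j ∈ P n →
                  (∑ᶠ k : Fin 2 → ℤ, a (j - k) * x k) = y j) ∧
                (∑ᶠ j : Fin 2 → ℤ, ‖x j‖) ≤ c * ∑ᶠ j : Fin 2 → ℤ, ‖y j‖) ∧
              (∀ x' : (Fin 2 → ℤ) → ℂ,
                Function.support x' ⊆ {k : Fin 2 → ℤ | latticeCoe k ∈ P n} →
                (∀ j : Fin 2 → ℤ, latticeCoe j ∈ P n →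
                  (∑ᶠ k : Fin 2 → ℤ, a (j - k) * x' k) = y j) →
                x' = x)) := by
  obtain ⟨h, hc, hper, hexp⟩ := hindex
  obtain ⟨H, hH, hHe⟩ := ks_log ha.toFinset a h hc hper (fun θ => by
    rw [← hexp, ksSymbol]
    symm
    refine finsum_eq_sum_of_support_subset _ fun k hk => ?_
    simpa using left_ne_zero_of_mul hk)
  obtain ⟨C, ρ, hC, hρ, hloc⟩ := ks_local ha.toFinset a H hH hHe
  obtain ⟨d, hd, hsd⟩ := ks_bound ha.toFinset
  obtain ⟨P, hP1, hP2, hP3⟩ := ks_geo (2 * (ρ + d) + 1) (by omega)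
  refine ⟨((2 * (ρ + d) + 1 : ℤ) : ℝ), 1, 2 * C, by exact_mod_cast (by omega : 0 < 2 * (ρ + d) + 1),
    one_pos, by positivity, P, hP1, hP2, fun n => ⟨hP3 n, fun y hy => ?_⟩⟩
  refine ks_fin ha.toFinset a (fun k hk => by simpa using hk) hC hρ hd hsd hloc
    {k : Fin 2 → ℤ | latticeCoe k ∈ P n} (hP3 n) (fun k hk => ?_) y hy
  obtain ⟨M, hM, hM'⟩ := (hP1 n).2.1 (latticeCoe k)
  refine ⟨M, hM, fun j hj => ?_⟩
  have hball : latticeCoe j ∈ Metric.ball (latticeCoe k) ((2 * (ρ + d) + 1 : ℤ) : ℝ) := by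
    rw [Metric.mem_ball, EuclideanSpace.dist_eq, Fin.sum_univ_two]
    have h0 : ∀ i, dist (latticeCoe j i) (latticeCoe k i) ≤ (ρ + d : ℝ) := fun i => by
      rw [Real.dist_eq, latticeCoe_apply, latticeCoe_apply]
      exact_mod_cast hj i
    have hrd : (0:ℝ) ≤ ρ + d := by exact_mod_cast add_nonneg hρ hd
    rw [Real.sqrt_lt' (by push_cast; linarith)]
    have h1 := pow_le_pow_left₀ dist_nonneg (h0 0) 2
    have h2 := pow_le_pow_left₀ dist_nonneg (h0 1) 2
    push_cast
    nlinarith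
  have := Set.ext_iff.1 hM' j
  constructor
  · exact fun hj' => (this.1 ⟨hj', hball⟩).1
  · exact fun hj' => (this.2 ⟨hj', hball⟩).1

end
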